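/- Fix R > 0. There exists a constant C = C(R) > 0 such that uniformly for all real x ≥ 3, all integers k with 1 ≤ k ≤ R·log₂x, and all reals 2 ≤ P < Q ≤ x, the number of integers n ∈ (x, 2x] with ω(n) = k and gcd(n, ∏_{P < p ≤ Q} p) = 1 is at most C·δ_k(x)·x·(log P / log Q)^κ, where κ := (k−1)/log₂x. -/

import Mathlib

open scoped Classical BigOperators
open MeasureTheory

/-- Number of distinct prime factors. -/
noncomputable def smallOmega (n : ℕ) : ℕ := n.primeFactors.card

/-- `π_k(x)`: number of integers `n ≤ x` with `ω(n) = k`. -/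
noncomputable def pik (k : ℕ) (x : ℝ) : ℕ :=
  ((Finset.Icc 1 ⌊x⌋₊).filter (fun n => smallOmega n = k)).card

/-- Iterated logarithm `log₂ = log ∘ log`. -/
noncomputable def log₂ (x : ℝ) : ℝ := Real.log (Real.log x)

/-- `λ(z) = Γ(z+1)⁻¹ ∏_p (1 + z/(p-1)) (1 - 1/p)^z`. -/
noncomputable def lambdaFn (z : ℝ) : ℝ :=
  (Real.Gamma (z + 1))⁻¹ *
    ∏' p : Nat.Primes, ((1 + z / (((p : ℕ) : ℝ) - 1)) * (1 - 1 / ((p : ℕ) : ℝ)) ^ z)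

/-- `δ_k(x) = λ(κ) (log₂ x)^{k-1} / ((log x) (k-1)!)`, with `κ = (k-1)/log₂ x`. -/
noncomputable def deltak (k : ℕ) (x : ℝ) : ℝ :=
  lambdaFn (((k : ℝ) - 1) / log₂ x) * (log₂ x) ^ (k - 1) /
    (Real.log x * (Nat.factorial (k - 1) : ℝ))


def badfree (bad : ℕ → Prop) (n : ℕ) : Prop := ∀ p : ℕ, p.Prime → bad p → ¬ p ∣ n

noncomputable def Sset (bad : ℕ → Prop) (k N : ℕ) : Finset ℕ :=
  (Finset.Icc 1 N).filter (fun n => smallOmega n = k ∧ badfree bad n)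

noncomputable def Vset (bad : ℕ → Prop) (N : ℕ) : Finset ℕ :=
  (Finset.Icc 1 N).filter (fun v => IsPrimePow v ∧ badfree bad v)

lemma decomp (bad : ℕ → Prop) (k N : ℕ) (F : ℕ → ℕ → ℝ) (hF : ∀ v m, 0 ≤ F v m) :
    ∑ n ∈ Sset bad (k+1) N, ∑ p ∈ n.primeFactors, F (ordProj[p] n) (ordCompl[p] n)
      ≤ ∑ m ∈ Sset bad k N, ∑ v ∈ (Vset bad N).filter (fun v => v * m ≤ N), F v m := by
  rw [Finset.sum_sigma', Finset.sum_sigma']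
  have key : ∀ a ∈ (Sset bad (k+1) N).sigma (fun n => n.primeFactors),
      (⟨ordCompl[a.2] a.1, ordProj[a.2] a.1⟩ : Σ _ : ℕ, ℕ) ∈
      (Sset bad k N).sigma (fun m => (Vset bad N).filter (fun v => v * m ≤ N)) := by
    rintro ⟨n, p⟩ h
    simp only [Finset.mem_sigma, Sset, Vset, Finset.mem_filter, Finset.mem_Icc] at h ⊢
    obtain ⟨⟨⟨h1, h2⟩, h3, h4⟩, h5⟩ := h
    have hp := Nat.prime_of_mem_primeFactors h5
    have hd := Nat.dvd_of_mem_primeFactors h5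
    have hn : n ≠ 0 := by omega
    have hpos : 0 < ordProj[p] n := Nat.ordProj_pos n p
    have hcpos : 0 < ordCompl[p] n := Nat.ordCompl_pos p hn
    have hmul : ordProj[p] n * ordCompl[p] n = n := Nat.ordProj_mul_ordCompl_eq_self n p
    have hd1 : ordProj[p] n ∣ n := Nat.ordProj_dvd n p
    have hd2 : ordCompl[p] n ∣ n := Nat.ordCompl_dvd n p
    refine ⟨⟨⟨hcpos, (Nat.le_of_dvd (by omega) hd2).trans h2⟩, ?_, ?_⟩,
      ⟨⟨hpos, (Nat.le_of_dvd (by omega) hd1).trans h2⟩, ?_, ?_⟩, ?_⟩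
    · unfold smallOmega at *
      have : (ordCompl[p] n).primeFactors = n.primeFactors.erase p := by
        rw [← Nat.support_factorization, Nat.factorization_ordCompl, Finsupp.support_erase,
          Nat.support_factorization]
      rw [this, Finset.card_erase_of_mem h5, h3]; rfl
    · exact fun q hq hb hqd => h4 q hq hb (hqd.trans hd2)
    · exact hp.isPrimePow.pow (Nat.pos_iff_ne_zero.1 (hp.factorization_pos_of_dvd hn hd))
    · exact fun q hq hb hqd => h4 q hq hb (hqd.trans hd1)
    · rw [hmul]; exact h2
  have inj : Set.InjOn (fun a : (Σ _ : ℕ, ℕ) => (⟨ordCompl[a.2] a.1, ordProj[a.2] a.1⟩ : Σ _ : ℕ, ℕ))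
      ((Sset bad (k+1) N).sigma (fun n => n.primeFactors) : Finset _) := by
    rintro ⟨n, p⟩ h ⟨n', p'⟩ h' heq
    simp only [Finset.coe_sigma, Set.mem_sigma_iff, Finset.mem_coe] at h h'
    simp only [Sigma.mk.injEq, heq_eq_eq] at heq
    have e1 : n = n' := by
      rw [← Nat.ordProj_mul_ordCompl_eq_self n p, ← Nat.ordProj_mul_ordCompl_eq_self n' p', heq.1, heq.2]
    subst e1
    have hp := Nat.prime_of_mem_primeFactors h.2
    have hp' := Nat.prime_of_mem_primeFactors h'.2
    have hd := Nat.dvd_of_mem_primeFactors h.2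
    have hn : n ≠ 0 := by rintro rfl; simp at h
    have hpos := hp.factorization_pos_of_dvd hn hd
    have : p ∣ p' ^ n.factorization p' := by
      rw [← heq.2]; exact dvd_pow_self _ (by omega)
    have := (Nat.prime_dvd_prime_iff_eq hp hp').1 (hp.dvd_of_dvd_pow this)
    subst this; rfl
  rw [← Finset.sum_image (f := fun b : (Σ _ : ℕ, ℕ) => F b.2 b.1) (s := (Sset bad (k+1) N).sigma (fun n => n.primeFactors)) inj]
  apply Finset.sum_le_sum_of_subset_of_nonneg
  · intro b hb
    obtain ⟨a, ha, rfl⟩ := Finset.mem_image.1 hb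
    exact key a ha
  · intros; apply hF

lemma recip_step (bad : ℕ → Prop) (N : ℕ) (k : ℕ) :
    ∑ m ∈ Sset bad k N, (1:ℝ) / m ≤ (∑ v ∈ Vset bad N, (1:ℝ)/v) ^ k / k.factorial := by
  induction k with
  | zero =>
    have : Sset bad 0 N ⊆ {1} := by
      intro n hn
      simp only [Sset, smallOmega, Finset.mem_filter, Finset.mem_Icc, Finset.card_eq_zero, Nat.primeFactors_eq_empty] at hn
      simp; omega
    calc _ ≤ ∑ m ∈ ({1} : Finset ℕ), (1:ℝ)/m :=
          Finset.sum_le_sum_of_subset_of_nonneg this (by intros; positivity)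
      _ = _ := by simp
  | succ k ih =>
    have h := decomp bad k N (fun v m => (1:ℝ) / v * (1 / m)) (by intros; positivity)
    have hl : ∑ n ∈ Sset bad (k+1) N, ∑ p ∈ n.primeFactors, (1:ℝ) / ((ordProj[p] n : ℕ) : ℝ) * (1 / ((ordCompl[p] n : ℕ) : ℝ)) = (k+1) * ∑ m ∈ Sset bad (k+1) N, (1:ℝ) / m := by
      rw [Finset.mul_sum]
      refine Finset.sum_congr rfl fun n hn => ?_
      have : ∀ p ∈ n.primeFactors, (1:ℝ) / ((ordProj[p] n : ℕ) : ℝ) * (1 / ((ordCompl[p] n : ℕ) : ℝ)) = 1 / n := by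
        intro p _
        rw [one_div_mul_one_div, ← Nat.cast_mul, Nat.ordProj_mul_ordCompl_eq_self]
      rw [Finset.sum_congr rfl this, Finset.sum_const, nsmul_eq_mul]
      unfold Sset at hn
      have hc : n.primeFactors.card = k + 1 := (Finset.mem_filter.1 hn).2.1
      rw [hc]; push_cast; rfl
    rw [hl] at h
    have hr : ∑ m ∈ Sset bad k N, ∑ v ∈ (Vset bad N).filter (fun v => v * m ≤ N), (1:ℝ) / v * (1 / m)
        ≤ (∑ v ∈ Vset bad N, (1:ℝ)/v) * ∑ m ∈ Sset bad k N, (1:ℝ)/m := by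
      rw [Finset.mul_sum]
      refine Finset.sum_le_sum fun m _ => ?_
      rw [Finset.sum_mul]
      exact Finset.sum_le_sum_of_subset_of_nonneg (Finset.filter_subset _ _) (by intros; positivity)
    have hV : 0 ≤ ∑ v ∈ Vset bad N, (1:ℝ)/v := Finset.sum_nonneg (by intros; positivity)
    have h3 := (h.trans hr).trans (mul_le_mul_of_nonneg_left ih hV)
    rw [Nat.factorial_succ]; push_cast
    rw [le_div_iff₀ (by positivity)]
    have hf : (0:ℝ) < k.factorial := by positivity
    calc _ = ((k+1) * ∑ m ∈ Sset bad (k+1) N, (1:ℝ) / m) * k.factorial := by ring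
      _ ≤ _ := by
        rw [← le_div_iff₀ hf]; refine h3.trans (le_of_eq ?_); ring

/-- log-weighted count -/
lemma log_step (bad : ℕ → Prop) (N k : ℕ) (C : ℝ)
    (hC : ∀ y : ℝ, 0 ≤ y → ∑ v ∈ (Finset.Icc 1 ⌊y⌋₊).filter IsPrimePow, Real.log v ≤ C * y) :
    ∑ n ∈ Sset bad (k+1) N, Real.log n ≤ C * N * ∑ m ∈ Sset bad k N, (1:ℝ) / m := by
  have h := decomp bad k N (fun v m => Real.log v) (by intros; exact Real.log_natCast_nonneg _)
  have hl : ∑ n ∈ Sset bad (k+1) N, ∑ p ∈ n.primeFactors, Real.log ((ordProj[p] n : ℕ) : ℝ) = ∑ n ∈ Sset bad (k+1) N, Real.log n := by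
    refine Finset.sum_congr rfl fun n hn => ?_
    simp only [Sset, Finset.mem_filter, Finset.mem_Icc] at hn
    have hn0 : n ≠ 0 := by omega
    rw [← Real.log_prod (fun p hp => by have := Nat.ordProj_pos n p; positivity), ← Nat.cast_prod]
    congr 2
    exact Nat.prod_factorization_pow_eq_self hn0
  rw [hl] at h
  refine h.trans ?_
  rw [Finset.mul_sum]
  refine Finset.sum_le_sum fun m hm => ?_
  simp only [Sset, Finset.mem_filter, Finset.mem_Icc] at hm
  have hm0 : (0:ℝ) < m := by exact_mod_cast hm.1.1
  calc _ ≤ ∑ v ∈ (Finset.Icc 1 ⌊(N:ℝ)/m⌋₊).filter IsPrimePow, Real.log v := by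
        refine Finset.sum_le_sum_of_subset_of_nonneg ?_ (by intros; exact Real.log_natCast_nonneg _)
        intro v hv
        simp only [Vset, Finset.mem_filter, Finset.mem_Icc] at hv ⊢
        refine ⟨⟨hv.1.1.1, Nat.le_floor ?_⟩, hv.1.2.1⟩
        rw [le_div_iff₀ hm0]; exact_mod_cast hv.2
    _ ≤ C * (N/m) := hC _ (by positivity)
    _ = _ := by ring

lemma npp_sum : ∃ B : ℝ, 0 < B ∧ ∀ s : Finset ℕ, (∀ v ∈ s, IsPrimePow v ∧ ¬ v.Prime) →
    ∑ v ∈ s, Real.log v / v ≤ B := by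
  have s1 : Summable (fun p : ℕ => Real.log p / (p:ℝ)^2) := by
    have h : Summable (fun p : ℕ => 2 * (1 / (p:ℝ)^(3/2:ℝ))) :=
      (Real.summable_one_div_nat_rpow.2 (by norm_num)).mul_left 2
    refine Summable.of_nonneg_of_le (fun p => by have := Real.log_natCast_nonneg p; positivity) (fun p => ?_) h
    rcases Nat.eq_zero_or_pos p with rfl | hp
    · simp
    have hp' : (0:ℝ) < p := by exact_mod_cast hp
    have := Real.log_le_rpow_div hp'.le (show (0:ℝ) < 1/2 by norm_num)
    rw [div_le_iff₀ (by positivity)]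
    have e : (p:ℝ)^2 = (p:ℝ)^(3/2:ℝ) * (p:ℝ)^(1/2:ℝ) := by
      rw [← Real.rpow_add hp', ← Real.rpow_natCast]; norm_num
    rw [e]
    have : (0:ℝ) < (p:ℝ)^(3/2:ℝ) := by positivity
    field_simp
    linarith
  have s2 : Summable (fun a : ℕ => (a:ℝ) * (1/2:ℝ)^a * 4) := by
    have := summable_pow_mul_geometric_of_norm_lt_one 1 (r := (1/2:ℝ)) (by norm_num)
    simpa using this.mul_right 4
  have s3 := s1.mul_of_nonneg s2 (fun p => by have := Real.log_natCast_nonneg p; positivity) (fun a => by positivity)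
  refine ⟨(∑' x : ℕ × ℕ, Real.log x.1 / (x.1:ℝ)^2 * ((x.2:ℝ) * (1/2:ℝ)^x.2 * 4)) + 1, ?_, ?_⟩
  · have : 0 ≤ ∑' x : ℕ × ℕ, Real.log x.1 / (x.1:ℝ)^2 * ((x.2:ℝ) * (1/2:ℝ)^x.2 * 4) :=
      tsum_nonneg fun x => by have := Real.log_natCast_nonneg x.1; positivity
    linarith
  intro s hs
  have hinj : Set.InjOn (fun v : ℕ => (v.minFac, v.factorization v.minFac)) (s : Set ℕ) := by
    intro v hv w hw h
    simp only [Prod.mk.injEq] at h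
    rw [← (hs v hv).1.minFac_pow_factorization_eq, ← (hs w hw).1.minFac_pow_factorization_eq, h.2, h.1]
  have : ∑ v ∈ s, Real.log v / v ≤ ∑ v ∈ s, (fun x : ℕ × ℕ => Real.log x.1 / (x.1:ℝ)^2 * ((x.2:ℝ) * (1/2:ℝ)^x.2 * 4)) ((fun v : ℕ => (v.minFac, v.factorization v.minFac)) v) := by
    refine Finset.sum_le_sum fun v hv => ?_
    have hv' := hs v hv
    obtain ⟨p, a, hp, ha, rfl⟩ := (isPrimePow_nat_iff _).1 hv'.1
    have ha2 : 2 ≤ a := by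
      by_contra h
      have : a = 1 := by omega
      subst this
      exact hv'.2 (by simpa using hp)
    simp only [hp.pow_minFac ha.ne', hp.factorization_pow, Finsupp.single_eq_same]
    push_cast
    rw [Real.log_pow]
    obtain ⟨b, rfl⟩ := Nat.exists_eq_add_of_le ha2
    have hp2 : (2:ℝ) ≤ p := by exact_mod_cast hp.two_le
    have hl := Real.log_natCast_nonneg p
    have hpb : (2:ℝ)^b ≤ (p:ℝ)^b := by gcongr
    rw [div_mul_eq_mul_div, div_le_div_iff₀ (by positivity) (by positivity)]
    push_cast
    have e : (1/2:ℝ)^(2+b) * 4 * (2:ℝ)^b = 1 := by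
      rw [pow_add, mul_right_comm, mul_assoc _ _ ((2:ℝ)^b), ← mul_pow]; norm_num
    have h1 : 1 ≤ (1/2:ℝ)^(2+b) * 4 * (p:ℝ)^b := by
      exact e.symm.le.trans (by gcongr)
    calc (2 + (b:ℝ)) * Real.log p * (p:ℝ)^2 = ((2 + (b:ℝ)) * Real.log p * (p:ℝ)^2) * 1 := by ring
      _ ≤ ((2 + (b:ℝ)) * Real.log p * (p:ℝ)^2) * ((1/2:ℝ)^(2+b) * 4 * (p:ℝ)^b) := by gcongr
      _ = _ := by ring
  rw [← Finset.sum_image (f := fun x : ℕ × ℕ => Real.log x.1 / (x.1:ℝ)^2 * ((x.2:ℝ) * (1/2:ℝ)^x.2 * 4)) hinj] at this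
  have h2 := s3.sum_le_tsum (s.image (fun v : ℕ => (v.minFac, v.factorization v.minFac)))
    (fun x _ => by have := Real.log_natCast_nonneg x.1; positivity)
  linarith

lemma pp_log_sum : ∃ C : ℝ, 0 < C ∧ ∀ y : ℝ, 0 ≤ y →
    ∑ v ∈ (Finset.Icc 1 ⌊y⌋₊).filter IsPrimePow, Real.log v ≤ C * y := by
  obtain ⟨B, hB, hs⟩ := npp_sum
  refine ⟨Real.log 4 + B, by positivity, fun y hy => ?_⟩
  rw [← Finset.sum_filter_add_sum_filter_not _ (fun v : ℕ => v.Prime), add_mul]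
  refine add_le_add ?_ ?_
  · refine le_trans ?_ (Chebyshev.theta_le_log4_mul_x hy)
    rw [Chebyshev.theta_eq_sum_Icc]
    refine Finset.sum_le_sum_of_subset_of_nonneg ?_ (by intros; exact Real.log_natCast_nonneg _)
    intro v hv
    simp only [Finset.mem_filter, Finset.mem_Icc] at hv ⊢
    exact ⟨⟨by omega, hv.1.1.2⟩, hv.2⟩
  · have := hs (((Finset.Icc 1 ⌊y⌋₊).filter IsPrimePow).filter (fun v => ¬ v.Prime))
      (fun v hv => by simp only [Finset.mem_filter] at hv; exact ⟨hv.1.2, hv.2⟩)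
    calc _ ≤ ∑ v ∈ ((Finset.Icc 1 ⌊y⌋₊).filter IsPrimePow).filter (fun v => ¬ v.Prime), Real.log v / v * y := by
          refine Finset.sum_le_sum fun v hv => ?_
          simp only [Finset.mem_filter, Finset.mem_Icc] at hv
          have h1 : (0:ℝ) < v := by exact_mod_cast hv.1.1.1
          have h2 : (v:ℝ) ≤ y := (Nat.le_floor_iff hy).1 hv.1.1.2
          rw [div_mul_eq_mul_div, le_div_iff₀ h1]
          have := Real.log_natCast_nonneg v
          gcongr
      _ ≤ _ := by rw [← Finset.sum_mul]; gcongr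

noncomputable def Aprime (N : ℕ) : ℝ := ∑ p ∈ (Finset.Icc 1 N).filter Nat.Prime, Real.log p / p

lemma sum_log_eq (N : ℕ) : ∑ n ∈ Finset.Icc 1 N, Real.log n =
    ∑ d ∈ Finset.Icc 1 N, ArithmeticFunction.vonMangoldt d * ((N / d : ℕ) : ℝ) := by
  have : ∀ n ∈ Finset.Icc 1 N, Real.log n = ∑ d ∈ Finset.Icc 1 N, if d ∣ n then ArithmeticFunction.vonMangoldt d else 0 := by
    intro n hn
    rw [Finset.mem_Icc] at hn
    rw [← ArithmeticFunction.vonMangoldt_sum, ← Finset.sum_filter]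
    refine Finset.sum_congr ?_ (fun _ _ => rfl)
    ext d
    simp only [Nat.mem_divisors, Finset.mem_filter, Finset.mem_Icc]
    constructor
    · rintro ⟨h, _⟩
      exact ⟨⟨Nat.pos_of_dvd_of_pos h (by omega), (Nat.le_of_dvd (by omega) h).trans hn.2⟩, h⟩
    · rintro ⟨_, h⟩; exact ⟨h, by omega⟩
  rw [Finset.sum_congr rfl this, Finset.sum_comm]
  refine Finset.sum_congr rfl fun d hd => ?_
  rw [← Finset.sum_filter, Finset.sum_const, nsmul_eq_mul, mul_comm]
  congr 2
  rw [← Nat.Ioc_filter_dvd_card_eq_div]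
  rfl

lemma mertens1 : ∃ K : ℝ, 0 < K ∧ ∀ N : ℕ, 1 ≤ N → |Aprime N - Real.log N| ≤ K := by
  obtain ⟨B, hB, hs⟩ := npp_sum
  refine ⟨Real.log 4 + 4 + 1 + B, by positivity, fun N hN => ?_⟩
  have hN0 : (0:ℝ) < N := by exact_mod_cast hN
  set A := ∑ d ∈ Finset.Icc 1 N, ArithmeticFunction.vonMangoldt d / d with hA
  have hfac : ∑ n ∈ Finset.Icc 1 N, Real.log n = Real.log (N.factorial) := by
    rw [← Finset.prod_Ico_id_eq_factorial, show Finset.Ico 1 (N+1) = Finset.Icc 1 N from rfl, Nat.cast_prod, Real.log_prod]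
    intro i hi; simp only [Finset.mem_Icc] at hi; norm_cast; omega
  have hup : ∑ n ∈ Finset.Icc 1 N, Real.log n ≤ N * Real.log N := by
    have : ∑ n ∈ Finset.Icc 1 N, Real.log n ≤ ∑ n ∈ Finset.Icc 1 N, Real.log N := by
      refine Finset.sum_le_sum fun n hn => ?_
      simp only [Finset.mem_Icc] at hn
      exact Real.log_le_log (by exact_mod_cast hn.1) (by exact_mod_cast hn.2)
    simpa using this
  have hlo : N * Real.log N - N ≤ ∑ n ∈ Finset.Icc 1 N, Real.log n := by
    rw [hfac]
    have := Stirling.le_log_factorial_stirling (n := N) (by omega)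
    have h1 := Real.log_natCast_nonneg N
    have h2 : 0 ≤ Real.log (2 * Real.pi) := Real.log_nonneg (by have := Real.pi_gt_three; linarith)
    linarith
  have hpsi : ∑ d ∈ Finset.Icc 1 N, ArithmeticFunction.vonMangoldt d ≤ (Real.log 4 + 4) * N := by
    refine le_trans (le_of_eq ?_) (Chebyshev.psi_le_const_mul_self hN0.le)
    rw [Chebyshev.psi, Nat.floor_natCast]; rfl
  have h1 : N * A ≤ N * Real.log N + (Real.log 4 + 4) * N := by
    have : N * A ≤ ∑ d ∈ Finset.Icc 1 N, ArithmeticFunction.vonMangoldt d * ((N / d : ℕ) : ℝ) + ∑ d ∈ Finset.Icc 1 N, ArithmeticFunction.vonMangoldt d := by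
      rw [hA, Finset.mul_sum, ← Finset.sum_add_distrib]
      refine Finset.sum_le_sum fun d hd => ?_
      simp only [Finset.mem_Icc] at hd
      have h := Nat.lt_floor_add_one ((N:ℝ)/d)
      rw [Nat.floor_div_eq_div] at h
      have hv : 0 ≤ ArithmeticFunction.vonMangoldt d := ArithmeticFunction.vonMangoldt_nonneg
      calc (N:ℝ) * (ArithmeticFunction.vonMangoldt d / d) = ArithmeticFunction.vonMangoldt d * (N/d) := by ring
        _ ≤ ArithmeticFunction.vonMangoldt d * (((N/d : ℕ):ℝ) + 1) := by gcongr
        _ = _ := by ring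
    rw [← sum_log_eq] at this
    linarith
  have h2 : N * Real.log N - N ≤ N * A := by
    refine hlo.trans ?_
    rw [sum_log_eq, hA, Finset.mul_sum]
    refine Finset.sum_le_sum fun d hd => ?_
    have hv : 0 ≤ ArithmeticFunction.vonMangoldt d := ArithmeticFunction.vonMangoldt_nonneg
    calc _ ≤ ArithmeticFunction.vonMangoldt d * ((N:ℝ)/d) := by gcongr; exact Nat.cast_div_le
      _ = _ := by ring
  have h1' : A ≤ Real.log N + (Real.log 4 + 4) := by
    refine le_of_mul_le_mul_left (h1.trans (le_of_eq ?_)) hN0; ring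
  have h2' : Real.log N - 1 ≤ A := by
    refine le_of_mul_le_mul_left (le_trans (le_of_eq ?_) h2) hN0; ring
  have hsplit : A = Aprime N + ∑ d ∈ (Finset.Icc 1 N).filter (fun d => ¬ d.Prime), ArithmeticFunction.vonMangoldt d / d := by
    rw [hA, ← Finset.sum_filter_add_sum_filter_not _ (fun v : ℕ => v.Prime), Aprime]
    congr 1
    refine Finset.sum_congr rfl fun p hp => ?_
    rw [ArithmeticFunction.vonMangoldt_apply_prime (Finset.mem_filter.1 hp).2]
  have hnp0 : 0 ≤ ∑ d ∈ (Finset.Icc 1 N).filter (fun d => ¬ d.Prime), ArithmeticFunction.vonMangoldt d / d :=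
    Finset.sum_nonneg fun d _ => div_nonneg ArithmeticFunction.vonMangoldt_nonneg (by positivity)
  have hnp1 : ∑ d ∈ (Finset.Icc 1 N).filter (fun d => ¬ d.Prime), ArithmeticFunction.vonMangoldt d / d ≤ B := by
    refine le_trans ?_ (hs (((Finset.Icc 1 N).filter (fun d => ¬ d.Prime)).filter IsPrimePow) (fun v hv => ?_))
    · rw [Finset.sum_filter IsPrimePow]
      refine Finset.sum_le_sum fun d hd => ?_
      split_ifs with h
      · gcongr; exact ArithmeticFunction.vonMangoldt_le_log
      · rw [ArithmeticFunction.vonMangoldt_eq_zero_iff.2 h]; simp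
    · simp only [Finset.mem_filter] at hv; exact ⟨hv.2, hv.1.2⟩
  have h4 : 0 ≤ Real.log 4 := Real.log_nonneg (by norm_num)
  rw [abs_le]; constructor <;> linarith

noncomputable def Hprime (N : ℕ) : ℝ := ∑ p ∈ (Finset.Icc 1 N).filter Nat.Prime, (1:ℝ) / p

lemma Aprime_succ (N : ℕ) : Aprime (N+1) = Aprime N + (if (N+1).Prime then Real.log (N+1 : ℕ) / (N+1 : ℕ) else 0) := by
  unfold Aprime
  rw [Finset.sum_filter, Finset.sum_filter, Finset.sum_Icc_succ_top (by omega)]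

lemma Hprime_succ (N : ℕ) : Hprime (N+1) = Hprime N + (if (N+1).Prime then (1:ℝ) / (N+1 : ℕ) else 0) := by
  unfold Hprime
  rw [Finset.sum_filter, Finset.sum_filter, Finset.sum_Icc_succ_top (by omega)]

lemma mertens2 : ∃ c : ℝ, 0 < c ∧ ∀ N : ℕ, 2 ≤ N → |Hprime N - Real.log (Real.log N)| ≤ c := by
  obtain ⟨K, hK, hm⟩ := mertens1
  -- invariant
  set c0 := |Hprime 2 - (Aprime 2 - Real.log 2) / Real.log 2 - Real.log (Real.log 2)| with hc0
  have hl2 : 0 < Real.log 2 := Real.log_pos (by norm_num)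
  have inv : ∀ N : ℕ, 2 ≤ N → |Hprime N - (Aprime N - Real.log N) / Real.log N - Real.log (Real.log N)|
      ≤ c0 + (K + Real.log 2) * (1 / Real.log 2 - 1 / Real.log N) := by
    intro N hN
    induction N, hN using Nat.le_induction with
    | base => simp [hc0]
    | succ N hN ih =>
      have hlN : 0 < Real.log N := Real.log_pos (by exact_mod_cast hN)
      have hNr : (2:ℝ) ≤ N := by exact_mod_cast hN
      set a := Real.log N with ha
      set b := Real.log (N+1 : ℕ) with hb
      have hab : a ≤ b := Real.log_le_log (by linarith) (by push_cast; linarith)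
      have hb0 : 0 < b := hlN.trans_le hab
      have hba : b - a ≤ Real.log 2 := by
        rw [hb, ha, ← Real.log_div (by positivity) (by positivity)]
        refine Real.log_le_log (by positivity) ?_
        rw [div_le_iff₀ (by positivity)]; push_cast; linarith
      have hr := hm N (by omega)
      rw [← ha] at hr
      have e : Hprime (N+1) = Hprime N + (Aprime (N+1) - Aprime N) / b := by
        rw [Hprime_succ, Aprime_succ]
        split_ifs with h
        · rw [← hb]; field_simp; ring
        · simp
      rw [e]
      -- loglog increments
      have g1 : Real.log b - Real.log a ≤ (b - a) / a := by
        rw [← Real.log_div hb0.ne' hlN.ne']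
        have := Real.log_le_sub_one_of_pos (show 0 < b / a by positivity)
        refine this.trans (le_of_eq ?_); field_simp
      have g2 : (b - a) / b ≤ Real.log b - Real.log a := by
        rw [← Real.log_div hb0.ne' hlN.ne']
        have := Real.one_sub_inv_le_log_of_pos (show 0 < b / a by positivity)
        refine le_trans (le_of_eq ?_) this; field_simp
      have g3 : (b - a) / a - (b - a) / b ≤ Real.log 2 * (1 / a - 1 / b) := by
        have : (b - a) / a - (b - a) / b = (b - a) * (1 / a - 1 / b) := by ring
        rw [this]
        refine mul_le_mul_of_nonneg_right hba ?_
        rw [sub_nonneg]; exact one_div_le_one_div_of_le hlN hab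
      have g4 : |(Aprime N - a) * (1 / a - 1 / b)| ≤ K * (1 / a - 1 / b) := by
        rw [abs_mul, abs_of_nonneg (a := 1 / a - 1 / b) (by rw [sub_nonneg]; exact one_div_le_one_div_of_le hlN hab)]
        refine mul_le_mul_of_nonneg_right hr ?_
        rw [sub_nonneg]; exact one_div_le_one_div_of_le hlN hab
      have id : Hprime N + (Aprime (N+1) - Aprime N) / b - (Aprime (N+1) - b) / b - Real.log b
          = (Hprime N - (Aprime N - a) / a - Real.log a) + (Aprime N - a) * (1 / a - 1 / b)
            + ((b - a)/b - (Real.log b - Real.log a)) := by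
        field_simp; ring
      rw [id]
      rw [abs_le] at ih g4 ⊢
      constructor <;> nlinarith [ih.1, ih.2, g4.1, g4.2]
  refine ⟨c0 + (K + Real.log 2) * (1 / Real.log 2) + K / Real.log 2, by positivity, fun N hN => ?_⟩
  have hlN : Real.log 2 ≤ Real.log N := Real.log_le_log (by norm_num) (by exact_mod_cast hN)
  have h1 := inv N hN
  have h2 : |(Aprime N - Real.log N) / Real.log N| ≤ K / Real.log 2 := by
    rw [abs_div, abs_of_pos (a := Real.log N) (by linarith)]
    exact div_le_div₀ hK.le (hm N (by omega)) hl2 hlN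
  have h3 : (K + Real.log 2) * (1 / Real.log 2 - 1 / Real.log N) ≤ (K + Real.log 2) * (1 / Real.log 2) := by
    have : 0 ≤ 1 / Real.log N := by positivity
    gcongr; linarith
  rw [abs_le] at h1 h2 ⊢
  constructor <;> linarith [h1.1, h1.2, h2.1, h2.2]

lemma lambda_lower (R : ℝ) (hR : 0 < R) : ∃ c : ℝ, 0 < c ∧ ∀ z : ℝ, 0 ≤ z → z ≤ R → c ≤ lambdaFn z := by
  have hcont : ContinuousOn Real.Gamma (Set.Icc 1 (R+1)) := by
    intro z hz
    refine (Real.differentiableAt_Gamma fun m => ?_).continuousAt.continuousWithinAt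
    have : (0:ℝ) ≤ m := by positivity
    intro h; have := hz.1; linarith
  obtain ⟨G, hG⟩ := isCompact_Icc.bddAbove_image hcont
  have hG' : ∀ z, 0 ≤ z → z ≤ R → Real.Gamma (z+1) ≤ G := fun z h0 h1 =>
    hG ⟨z+1, ⟨by linarith, by linarith⟩, rfl⟩
  have hGpos : 0 < G := (Real.Gamma_pos_of_pos (by norm_num : (0:ℝ) < 0 + 1)).trans_le (hG' 0 le_rfl hR.le)
  have hsum : Summable (fun p : Nat.Primes => 4 / (((p : ℕ) : ℝ))^2) := by
    have h : Summable (fun p : ℕ => 4 / (p:ℝ)^2) := by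
      simpa [div_eq_mul_inv] using (Real.summable_one_div_nat_pow.2 (by norm_num : 1 < 2)).mul_left 4
    exact h.comp_injective (i := fun p : Nat.Primes => (p:ℕ)) Subtype.val_injective
  set T := ∑' p : Nat.Primes, 4 / (((p : ℕ) : ℝ))^2 with hT
  have hT0 : 0 ≤ T := tsum_nonneg fun p => by positivity
  refine ⟨G⁻¹ * Real.exp (-(R^2 * T)), by positivity, fun z h0 h1 => ?_⟩
  unfold lambdaFn
  have hterm : ∀ p : Nat.Primes, Real.exp (-(R^2 * (4 / (((p : ℕ) : ℝ))^2))) ≤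
      (1 + z / (((p : ℕ) : ℝ) - 1)) * (1 - 1 / ((p : ℕ) : ℝ)) ^ z := by
    intro p
    have hp : (2:ℝ) ≤ ((p:ℕ):ℝ) := by exact_mod_cast p.2.two_le
    set q := ((p:ℕ):ℝ)
    have hq1 : 0 < q - 1 := by linarith
    have hb : 0 < 1 - 1 / q := by
      rw [sub_pos, div_lt_one (by linarith)]; linarith
    have hy : 0 ≤ z / (q - 1) := by positivity
    rw [Real.rpow_def_of_pos hb, ← Real.exp_log (show 0 < 1 + z / (q-1) by linarith), ← Real.exp_add, Real.exp_le_exp]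
    have l1 := Real.one_sub_inv_le_log_of_pos (show 0 < 1 + z / (q-1) by linarith)
    have l2 := Real.one_sub_inv_le_log_of_pos hb
    have e2 : 1 - (1 - 1/q)⁻¹ = - (1 / (q-1)) := by
      have : 1 - 1/q = (q-1)/q := by field_simp
      rw [this, inv_div]; field_simp; ring
    rw [e2] at l2
    have l3 : -(z/(q-1)) ≤ Real.log (1 - 1/q) * z := by
      have := mul_le_mul_of_nonneg_right l2 h0
      refine le_trans (le_of_eq ?_) this; ring
    have l4 : z/(q-1) - (z/(q-1))^2 ≤ 1 - (1 + z/(q-1))⁻¹ := by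
      generalize z/(q-1) = y at hy
      have : 1 - (1+y)⁻¹ = y / (1+y) := by field_simp; ring
      rw [this, le_div_iff₀ (by linarith)]
      nlinarith [pow_nonneg hy 3]
    have l5 : (z/(q-1))^2 ≤ R^2 * (4/q^2) := by
      have : z/(q-1) ≤ R * (2/q) := by
        rw [← mul_div_assoc, div_le_div_iff₀ hq1 (by linarith)]
        nlinarith
      calc _ ≤ (R * (2/q))^2 := by gcongr
        _ = _ := by ring
    linarith
  have hprod : Real.exp (-(R^2 * T)) ≤ ∏' p : Nat.Primes, ((1 + z / (((p : ℕ) : ℝ) - 1)) * (1 - 1 / ((p : ℕ) : ℝ)) ^ z) := by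
    by_cases hm : Multipliable (fun p : Nat.Primes => ((1 + z / (((p : ℕ) : ℝ) - 1)) * (1 - 1 / ((p : ℕ) : ℝ)) ^ z))
    · refine ge_of_tendsto' hm.hasProd fun s => ?_
      calc _ ≤ Real.exp (∑ p ∈ s, -(R^2 * (4 / (((p : ℕ) : ℝ))^2))) := by
            rw [Real.exp_le_exp, Finset.sum_neg_distrib, ← Finset.mul_sum, neg_le_neg_iff]
            gcongr
            exact hsum.sum_le_tsum s (fun p _ => by positivity)
        _ ≤ _ := by
            rw [Real.exp_sum]
            exact Finset.prod_le_prod (fun p _ => (Real.exp_pos _).le) (fun p _ => hterm p)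
    · rw [tprod_eq_one_of_not_multipliable hm]
      exact Real.exp_le_one_iff.2 (by have : 0 ≤ R^2*T := by positivity
                                      linarith)
  have hg : G⁻¹ ≤ (Real.Gamma (z+1))⁻¹ :=
    inv_anti₀ (Real.Gamma_pos_of_pos (by linarith)) (hG' z h0 h1)
  gcongr

lemma floor_loglog {Q : ℝ} (hQ : 2 ≤ Q) :
    Real.log (Real.log Q) - Real.log 2 ≤ Real.log (Real.log ⌊Q⌋₊) ∧
    Real.log (Real.log ⌊Q⌋₊) ≤ Real.log (Real.log Q) := by
  have h2 : 2 ≤ ⌊Q⌋₊ := Nat.le_floor (by exact_mod_cast hQ)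
  have h2r : (2:ℝ) ≤ ⌊Q⌋₊ := by exact_mod_cast h2
  have hf : (⌊Q⌋₊ : ℝ) ≤ Q := Nat.floor_le (by linarith)
  have hf' := Nat.lt_floor_add_one Q
  have hlq : 0 < Real.log Q := Real.log_pos (by linarith)
  have hlf : 0 < Real.log ⌊Q⌋₊ := Real.log_pos (by linarith)
  constructor
  · rw [← Real.log_div hlq.ne' (by norm_num)]
    refine Real.log_le_log (by positivity) ?_
    have : Real.log Q ≤ Real.log ((⌊Q⌋₊:ℝ)^2) := Real.log_le_log (by linarith) (by nlinarith)
    rw [Real.log_pow] at this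
    push_cast at this
    linarith
  · exact Real.log_le_log hlf (Real.log_le_log (by linarith) hf)

lemma Vsum_le : ∃ c : ℝ, 0 < c ∧ ∀ x : ℝ, 3 ≤ x → ∀ P Q : ℝ, 2 ≤ P → P < Q → Q ≤ x →
    ∑ v ∈ Vset (fun p => P < (p:ℝ) ∧ (p:ℝ) ≤ Q) ⌊2 * x⌋₊, (1:ℝ) / v ≤
      log₂ x - (Real.log (Real.log Q) - Real.log (Real.log P)) + c := by
  obtain ⟨c, hc, hm⟩ := mertens2
  obtain ⟨B, hB, hs⟩ := npp_sum
  have hl2 : 0 < Real.log 2 := Real.log_pos (by norm_num)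
  refine ⟨3 * c + B / Real.log 2 + 2 * Real.log 2, by positivity, fun x hx P Q hP hPQ hQ => ?_⟩
  set N := ⌊2 * x⌋₊ with hN
  have hQ2 : 2 ≤ Q := by linarith
  have hN2 : 2 ≤ N := Nat.le_floor (by push_cast; linarith)
  have hp2 : 2 ≤ ⌊P⌋₊ := Nat.le_floor (by exact_mod_cast hP)
  have hq2 : 2 ≤ ⌊Q⌋₊ := Nat.le_floor (by exact_mod_cast hQ2)
  have m1 := hm N hN2
  have m2 := hm _ hp2
  have m3 := hm _ hq2
  rw [abs_le] at m1 m2 m3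
  have f1 := (floor_loglog (show 2 ≤ 2 * x by linarith)).2
  rw [← hN] at f1
  have f2 := (floor_loglog hP).2
  have f3 := (floor_loglog hQ2).1
  have hlx : 0 < Real.log x := Real.log_pos (by linarith)
  have f4 : Real.log (Real.log (2 * x)) ≤ log₂ x + Real.log 2 := by
    unfold log₂
    rw [← Real.log_mul hlx.ne' (by norm_num)]
    refine Real.log_le_log (Real.log_pos (by linarith)) ?_
    rw [Real.log_mul (by norm_num) (by linarith)]
    have := Real.log_le_log (by norm_num) (show (2:ℝ) ≤ x by linarith)
    linarith
  -- non-prime part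
  have key2 : ∑ v ∈ (Vset (fun p => P < (p:ℝ) ∧ (p:ℝ) ≤ Q) N).filter (fun v => ¬ v.Prime), (1:ℝ) / v ≤ B / Real.log 2 := by
    rw [le_div_iff₀ hl2, Finset.sum_mul]
    refine le_trans (Finset.sum_le_sum fun v hv => ?_) (hs _ (fun v hv => ?_))
    · simp only [Vset, Finset.mem_filter] at hv
      have : (2:ℝ) ≤ v := by exact_mod_cast hv.1.2.1.two_le
      have := Real.log_le_log (by norm_num) this
      rw [one_div_mul_eq_div]
      gcongr
    · simp only [Vset, Finset.mem_filter] at hv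
      exact ⟨hv.1.2.1, hv.2⟩
  -- prime part
  have key1 : ∑ v ∈ (Vset (fun p => P < (p:ℝ) ∧ (p:ℝ) ≤ Q) N).filter (fun v => v.Prime), (1:ℝ) / v
      + (Hprime ⌊Q⌋₊ - Hprime ⌊P⌋₊) ≤ Hprime N := by
    have hsub : (Finset.Icc 1 ⌊P⌋₊).filter Nat.Prime ⊆ (Finset.Icc 1 ⌊Q⌋₊).filter Nat.Prime :=
      Finset.filter_subset_filter _ (Finset.Icc_subset_Icc_right (Nat.floor_le_floor hPQ.le))
    have e := Finset.sum_sdiff (f := fun p : ℕ => (1:ℝ)/p) hsub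
    have e' : Hprime ⌊Q⌋₊ - Hprime ⌊P⌋₊ = ∑ p ∈ (Finset.Icc 1 ⌊Q⌋₊).filter Nat.Prime \ (Finset.Icc 1 ⌊P⌋₊).filter Nat.Prime, (1:ℝ)/p := by
      unfold Hprime; linarith
    have hmem : ∀ p ∈ (Finset.Icc 1 ⌊Q⌋₊).filter Nat.Prime \ (Finset.Icc 1 ⌊P⌋₊).filter Nat.Prime,
        p.Prime ∧ P < (p:ℝ) ∧ (p:ℝ) ≤ Q ∧ 1 ≤ p ∧ p ≤ N := by
      intro p hp
      simp only [Finset.mem_sdiff, Finset.mem_filter, Finset.mem_Icc, not_and] at hp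
      obtain ⟨⟨⟨a, b⟩, c⟩, d⟩ := hp
      refine ⟨c, ?_, (Nat.le_floor_iff (by linarith)).1 b, a, b.trans (Nat.floor_le_floor (by linarith))⟩
      by_contra h
      exact d ⟨a, Nat.le_floor (not_lt.1 h)⟩ c
    rw [e', ← Finset.sum_union]
    · unfold Hprime
      refine Finset.sum_le_sum_of_subset_of_nonneg ?_ (by intros; positivity)
      intro p hp
      rw [Finset.mem_union] at hp
      rcases hp with hp | hp
      · simp only [Vset, Finset.mem_filter] at hp
        exact Finset.mem_filter.2 ⟨hp.1.1, hp.2⟩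
      · have := hmem p hp
        exact Finset.mem_filter.2 ⟨Finset.mem_Icc.2 this.2.2.2, this.1⟩
    · rw [Finset.disjoint_left]
      intro p hp hp'
      have := hmem p hp'
      simp only [Vset, Finset.mem_filter] at hp
      exact hp.1.2.2 p this.1 ⟨this.2.1, this.2.2.1⟩ dvd_rfl
  rw [← Finset.sum_filter_add_sum_filter_not _ (fun v : ℕ => v.Prime)]
  linarith [m1.1, m1.2, m2.1, m2.2, m3.1, m3.2]

theorem stmt9 (R : ℝ) (hR : 0 < R) :
    ∃ C : ℝ, 0 < C ∧ ∀ x : ℝ, 3 ≤ x →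
      ∀ k : ℕ, 1 ≤ k → (k : ℝ) ≤ R * log₂ x →
      ∀ P Q : ℝ, 2 ≤ P → P < Q → Q ≤ x →
      (((Finset.Ioc ⌊x⌋₊ ⌊2 * x⌋₊).filter
          (fun n => smallOmega n = k ∧
            ∀ p : ℕ, p.Prime → P < (p : ℝ) → (p : ℝ) ≤ Q → ¬ p ∣ n)).card : ℝ)
        ≤ C * (deltak k x * x *
            (Real.log P / Real.log Q) ^ (((k : ℝ) - 1) / log₂ x)) := by
  obtain ⟨c, hc, hV⟩ := Vsum_le
  obtain ⟨D, hD, hlog⟩ := pp_log_sum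
  obtain ⟨l, hl, hlam⟩ := lambda_lower R hR
  refine ⟨2 * D * Real.exp (c * R) / l, by positivity, fun x hx k hk hkR P Q hP hPQ hQ => ?_⟩
  obtain ⟨j, rfl⟩ := Nat.exists_eq_add_of_le' hk
  have hlx1 : 1 < Real.log x := by
    rw [Real.lt_log_iff_exp_lt (by linarith)]
    linarith [Real.exp_one_lt_d9]
  have hL : 0 < log₂ x := Real.log_pos hlx1
  have hlP : 0 < Real.log P := Real.log_pos (by linarith)
  have hlQ : 0 < Real.log Q := Real.log_pos (by linarith)
  set bad : ℕ → Prop := fun p => P < (p:ℝ) ∧ (p:ℝ) ≤ Q with hbad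
  set S := (Finset.Ioc ⌊x⌋₊ ⌊2 * x⌋₊).filter
          (fun n => smallOmega n = j + 1 ∧
            ∀ p : ℕ, p.Prime → P < (p : ℝ) → (p : ℝ) ≤ Q → ¬ p ∣ n) with hS
  set N := ⌊2 * x⌋₊ with hN
  set E := ∑ v ∈ Vset bad N, (1:ℝ) / v with hE
  have hE0 : 0 ≤ E := Finset.sum_nonneg (by intros; positivity)
  have hEle := hV x hx P Q hP hPQ hQ
  have hNx : (N:ℝ) ≤ 2 * x := Nat.floor_le (by linarith)
  set L := log₂ x with hLdef
  set t := Real.log (Real.log Q) - Real.log (Real.log P) with ht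
  set κ := (((j + 1 : ℕ) : ℝ) - 1) / L with hκ
  have hκj : κ = j / L := by rw [hκ]; push_cast; ring
  have hκ0 : 0 ≤ κ := by rw [hκj]; positivity
  have hκR : κ ≤ R := by
    rw [hκj, div_le_iff₀ hL]; push_cast at hkR; linarith
  -- count
  have h1 : (S.card : ℝ) * Real.log x ≤ D * (2 * x) * (E ^ j / j.factorial) := by
    have hsub : S ⊆ Sset bad (j+1) N := by
      intro n hn
      rw [hS, Finset.mem_filter, Finset.mem_Ioc] at hn
      rw [Sset, Finset.mem_filter, Finset.mem_Icc]
      exact ⟨⟨by omega, hn.1.2⟩, hn.2.1, fun p hp hb => hn.2.2 p hp hb.1 hb.2⟩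
    calc (S.card : ℝ) * Real.log x = ∑ n ∈ S, Real.log x := by simp
      _ ≤ ∑ n ∈ S, Real.log n := by
        refine Finset.sum_le_sum fun n hn => ?_
        rw [hS, Finset.mem_filter, Finset.mem_Ioc] at hn
        exact Real.log_le_log (by linarith) ((Nat.floor_lt (by linarith)).1 hn.1.1).le
      _ ≤ ∑ n ∈ Sset bad (j+1) N, Real.log n :=
        Finset.sum_le_sum_of_subset_of_nonneg hsub (by intros; exact Real.log_natCast_nonneg _)
      _ ≤ D * N * ∑ m ∈ Sset bad j N, (1:ℝ) / m := log_step bad N j D hlog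
      _ ≤ D * (2 * x) * (E ^ j / j.factorial) := by
        have := recip_step bad N j
        gcongr
  -- power
  have h2 : E ^ j ≤ L ^ j * Real.exp (c * R) * (Real.log P / Real.log Q) ^ κ := by
    have e1 : E ≤ L * Real.exp ((c - t) / L) := by
      have := Real.add_one_le_exp ((c - t) / L)
      calc E ≤ L - t + c := hEle
        _ = L * ((c - t) / L + 1) := by field_simp; ring
        _ ≤ _ := by gcongr
    have e2 : (Real.log P / Real.log Q) ^ κ = Real.exp (-t * κ) := by
      rw [Real.rpow_def_of_pos (by positivity), Real.log_div hlP.ne' hlQ.ne', ht]; ring_nf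
    calc E ^ j ≤ (L * Real.exp ((c - t) / L)) ^ j := by gcongr
      _ = L ^ j * Real.exp (c * κ) * Real.exp (-t * κ) := by
        rw [mul_pow, ← Real.exp_nat_mul, mul_assoc, ← Real.exp_add, hκj]
        congr 2; ring
      _ ≤ _ := by
        rw [e2]; gcongr
  have h3 := hlam κ hκ0 hκR
  set W := (Real.log P / Real.log Q) ^ κ with hW
  have hW0 : 0 ≤ W := by positivity
  have hfac : (0:ℝ) < j.factorial := by positivity
  unfold deltak
  rw [Nat.add_sub_cancel, ← hLdef, ← hκ]
  have h4 : (S.card : ℝ) ≤ D * (2 * x) * (L ^ j * Real.exp (c * R) * W / j.factorial) / Real.log x := by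
    rw [le_div_iff₀ (by linarith)]
    refine h1.trans ?_
    gcongr
  refine h4.trans ?_
  calc _ = 2 * D * Real.exp (c * R) / l * (l * L ^ j / (Real.log x * j.factorial) * x * W) := by
        field_simp
    _ ≤ _ := by gcongr
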